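/- arXiv:1309.3109 — 5 statements merged into one kernel-verified Lean document; each statement's English description precedes it below -/
import Mathlib

section
/- Let P be a strict Picard category and M_P = (B, Ob(P), d) its associated abelian crossed module. Then the assignment sending each object x of P to itself and each morphism u : x → y of P to u ⊗ id_{−y} (a morphism x ⊗ (−y) → y ⊗ (−y) = I of P, i.e. an element of B with domain x ⊗ (−y), hence a morphism x → y in P_{M_P}) is an isomorphism of categories P → P_{M_P} which is moreover a strict symmetric monoidal functor (it preserves ⊗ on objects and morphisms on the nose, with F̃ = id). -/
universe u v

/-- A strict Picard category: a symmetric monoidal category in which the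
associativity, unit and symmetry constraints are all identities (hence the object
equations below hold and the identity constraints are natural, expressed by the
`HEq` fields), every morphism is invertible, and every object has a strict tensor
inverse. -/
structure StrictPicardCategory where
  Obj : Type u
  Hom : Obj → Obj → Type v
  id : (x : Obj) → Hom x x
  comp : {x y z : Obj} → Hom x y → Hom y z → Hom x z
  id_comp : ∀ {x y : Obj} (u : Hom x y), comp (id x) u = u
  comp_id : ∀ {x y : Obj} (u : Hom x y), comp u (id y) = u
  comp_assoc : ∀ {w x y z : Obj} (u : Hom w x) (v : Hom x y) (t : Hom y z),
    comp (comp u v) t = comp u (comp v t)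
  tensor : Obj → Obj → Obj
  tHom : {x y x' y' : Obj} → Hom x y → Hom x' y' → Hom (tensor x x') (tensor y y')
  unit : Obj
  tHom_id : ∀ x x' : Obj, tHom (id x) (id x') = id (tensor x x')
  tHom_comp : ∀ {x y z x' y' z' : Obj} (u : Hom x y) (v : Hom y z)
    (u' : Hom x' y') (v' : Hom y' z'),
    tHom (comp u v) (comp u' v') = comp (tHom u u') (tHom v v')
  assoc_eq : ∀ x y z : Obj, tensor (tensor x y) z = tensor x (tensor y z)
  unit_left : ∀ x : Obj, tensor unit x = x
  unit_right : ∀ x : Obj, tensor x unit = x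
  comm_eq : ∀ x y : Obj, tensor x y = tensor y x
  assoc_nat : ∀ {x y x' y' x'' y'' : Obj} (u : Hom x y) (v : Hom x' y') (w : Hom x'' y''),
    HEq (tHom (tHom u v) w) (tHom u (tHom v w))
  lunit_nat : ∀ {x y : Obj} (u : Hom x y), HEq (tHom (id unit) u) u
  runit_nat : ∀ {x y : Obj} (u : Hom x y), HEq (tHom u (id unit)) u
  comm_nat : ∀ {x y x' y' : Obj} (u : Hom x y) (v : Hom x' y'), HEq (tHom u v) (tHom v u)
  mor_inv : ∀ {x y : Obj} (u : Hom x y), ∃ v : Hom y x, comp u v = id x ∧ comp v u = id y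
  obj_inv : ∀ x : Obj, ∃ y : Obj, tensor x y = unit

/-- The set `B` of morphisms of `P` with codomain the unit object: the underlying
set of the abelian crossed module `M_P = (B, Ob P, d)`, where `d (b : x → I) = x`. -/
def Mor (P : StrictPicardCategory.{u, v}) : Type max u v :=
  Σ x : P.Obj, P.Hom x P.unit

/-- The operation `b + c := b ⊗ c` on `B` (via the strict unit constraint
`I ⊗ I = I`). -/
def Mor.add {P : StrictPicardCategory.{u, v}} (a b : Mor P) : Mor P :=
  ⟨P.tensor a.1 b.1,
    cast (congrArg (P.Hom (P.tensor a.1 b.1)) (P.unit_left P.unit)) (P.tHom a.2 b.2)⟩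

/-- The zero element `id I` of `B`; this is also the identity morphism of any object
of the associated strict Picard category `P_{M_P}`. -/
def Mor.zero (P : StrictPicardCategory.{u, v}) : Mor P := ⟨P.unit, P.id P.unit⟩

/-- The map sending a morphism `u : x → y` of `P` to `u ⊗ id (−y)`, an element of
`B` with domain `x ⊗ (−y)` — i.e. a candidate morphism `x → y` of `P_{M_P}`
(the codomain `y ⊗ (−y)` is identified with `I` via `hneg`). -/
def Fmor {P : StrictPicardCategory.{u, v}} (neg : P.Obj → P.Obj)
    (hneg : ∀ x : P.Obj, P.tensor x (neg x) = P.unit)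
    {x y : P.Obj} (u : P.Hom x y) : Mor P :=
  ⟨P.tensor x (neg y),
    cast (congrArg (P.Hom (P.tensor x (neg y))) (hneg y)) (P.tHom u (P.id (neg y)))⟩

namespace StrictPicardCategory

/-- The type of all morphisms of `P`, a commutative monoid under `⊗`. -/
def Arr (P : StrictPicardCategory.{u, v}) : Type max u v :=
  Σ x : P.Obj, Σ y : P.Obj, P.Hom x y

variable {P : StrictPicardCategory.{u, v}}

/-- A morphism of `P` as an element of the monoid of all morphisms. -/
def arr {x y : P.Obj} (f : P.Hom x y) : P.Arr := ⟨x, y, f⟩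

theorem arr_eq_of_heq {x y x' y' : P.Obj} {f : P.Hom x y} {g : P.Hom x' y'}
    (hx : x = x') (hy : y = y') (h : HEq f g) : arr f = arr g := by
  subst hx hy
  rw [eq_of_heq h]

theorem arr_injective {x y : P.Obj} {f g : P.Hom x y} (h : arr f = arr g) : f = g := by
  exact eq_of_heq (Sigma.mk.inj (eq_of_heq (Sigma.mk.inj h).2)).2

theorem arr_cast {x y z : P.Obj} (h : y = z) (f : P.Hom x y) :
    arr (cast (congrArg (P.Hom x) h) f) = arr f := by
  subst h
  rfl

theorem arr_comp_congr {x y z z' : P.Obj} (u : P.Hom x y) {f : P.Hom y z} {g : P.Hom y z'}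
    (hz : z = z') (h : HEq f g) : arr (P.comp u f) = arr (P.comp u g) := by
  subst hz
  rw [eq_of_heq h]

instance : CommMonoid P.Arr where
  mul a b := arr (P.tHom a.2.2 b.2.2)
  one := arr (P.id P.unit)
  mul_assoc a b c :=
    arr_eq_of_heq (P.assoc_eq _ _ _) (P.assoc_eq _ _ _) (P.assoc_nat a.2.2 b.2.2 c.2.2)
  one_mul a := arr_eq_of_heq (P.unit_left _) (P.unit_left _) (P.lunit_nat a.2.2)
  mul_one a := arr_eq_of_heq (P.unit_right _) (P.unit_right _) (P.runit_nat a.2.2)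
  mul_comm a b := arr_eq_of_heq (P.comm_eq _ _) (P.comm_eq _ _) (P.comm_nat a.2.2 b.2.2)

theorem arr_tHom {x y x' y' : P.Obj} (f : P.Hom x y) (g : P.Hom x' y') :
    arr (P.tHom f g) = arr f * arr g := rfl

theorem arr_id_unit : arr (P.id P.unit) = 1 := rfl

theorem arr_id_tensor (x y : P.Obj) :
    arr (P.id (P.tensor x y)) = arr (P.id x) * arr (P.id y) := by
  rw [← arr_tHom, P.tHom_id]

theorem arr_id_mul_arr_id {x y : P.Obj} (h : P.tensor x y = P.unit) :
    arr (P.id x) * arr (P.id y) = 1 := by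
  rw [← arr_id_tensor, h, arr_id_unit]

theorem arr_mul_arr {x y z : P.Obj} (f : P.Hom x y) (g : P.Hom y z) :
    arr f * arr g = arr (P.comp f g) * arr (P.id y) := by
  have h₁ : P.tHom f g = P.comp (P.tHom f (P.id y)) (P.tHom (P.id y) g) := by
    rw [← P.tHom_comp, P.comp_id, P.id_comp]
  have h₂ : P.tHom (P.comp f g) (P.id y) =
      P.comp (P.tHom f (P.id y)) (P.tHom g (P.id y)) := by
    rw [← P.tHom_comp, P.comp_id]
  rw [← arr_tHom, ← arr_tHom, h₁, h₂]
  exact arr_comp_congr _ (P.comm_eq _ _) (P.comm_nat _ _)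

end StrictPicardCategory

open StrictPicardCategory

namespace Mor

variable {P : StrictPicardCategory.{u, v}}

theorem arr_snd_injective {a b : Mor P} (h : arr a.2 = arr b.2) : a = b := by
  obtain ⟨x, f⟩ := a
  obtain ⟨y, g⟩ := b
  obtain rfl : x = y := congrArg Sigma.fst h
  exact congrArg (Sigma.mk x) (arr_injective h)

theorem arr_add (a b : Mor P) : arr (a.add b).2 = arr a.2 * arr b.2 :=
  arr_cast (P.unit_left P.unit) _

end Mor

theorem arr_Fmor {P : StrictPicardCategory.{u, v}} (neg : P.Obj → P.Obj)
    (hneg : ∀ x : P.Obj, P.tensor x (neg x) = P.unit) {x y : P.Obj} (f : P.Hom x y) :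
    arr (Fmor neg hneg f).2 = arr f * arr (P.id (neg y)) :=
  arr_cast (hneg y) _

/-- Let `P` be a strict Picard category, `M_P = (B, Ob P, d)` its
associated abelian crossed module and `P_{M_P}` the strict Picard category
associated to `M_P` (objects: `Ob P`; morphisms `x → y`: elements `b ∈ B` with
`x = d b ⊗ y`; composition and tensor given by the addition `Mor.add` of `B`).
The assignment fixing each object and sending `u : x → y` to `u ⊗ id (−y)` is an
isomorphism of categories `P → P_{M_P}` which is moreover a strict symmetric
monoidal functor (it is the identity on objects and preserves `⊗` on the nose,
with `F̃ = id`). -/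
theorem strict_Picard_isomorphic_to_associated (P : StrictPicardCategory.{u, v})
    (neg : P.Obj → P.Obj) (hneg : ∀ x : P.Obj, P.tensor x (neg x) = P.unit) :
    -- `F u` is indeed a morphism `x → y` of `P_{M_P}`, i.e. `x = d (F u) ⊗ y`
    (∀ {x y : P.Obj} (u : P.Hom x y), P.tensor (Fmor neg hneg u).1 y = x) ∧
    -- `F` is a functor: it preserves identities ...
    (∀ x : P.Obj, Fmor neg hneg (P.id x) = Mor.zero P) ∧
    -- ... and composition (composition in `P_{M_P}` is `Mor.add`)
    (∀ {x y z : P.Obj} (u : P.Hom x y) (v : P.Hom y z),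
        Fmor neg hneg (P.comp u v) = (Fmor neg hneg u).add (Fmor neg hneg v)) ∧
    -- `F` is strict symmetric monoidal: it is the identity on objects (so it
    -- preserves `⊗`, the unit object and all the identity constraints on the nose,
    -- and `F̃ = id`), and it preserves `⊗` of morphisms on the nose
    (∀ {x y x' y' : P.Obj} (u : P.Hom x y) (v : P.Hom x' y'),
        Fmor neg hneg (P.tHom u v) = (Fmor neg hneg u).add (Fmor neg hneg v)) ∧
    -- `F` is an isomorphism of categories: bijective on objects ...
    Function.Bijective (fun x : P.Obj => x) ∧
    -- ... and bijective on each hom-set (onto the hom-set of `P_{M_P}`)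
    (∀ {x y : P.Obj} (u u' : P.Hom x y), Fmor neg hneg u = Fmor neg hneg u' → u = u') ∧
    (∀ (x y : P.Obj) (b : Mor P), P.tensor b.1 y = x →
        ∃ u : P.Hom x y, Fmor neg hneg u = b) := by
  have hid (x : P.Obj) : arr (P.id x) * arr (P.id (neg x)) = 1 := arr_id_mul_arr_id (hneg x)
  refine ⟨fun {x y} f => ?_, fun x => ?_, fun {x y z} f g => ?_, fun {x y x' y'} f g => ?_,
    Function.bijective_id, fun {x y} f g h => ?_, fun x y b hb => ?_⟩
  · change P.tensor (P.tensor x (neg y)) y = x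
    rw [P.assoc_eq, P.comm_eq (neg y), hneg, P.unit_right]
  · apply Mor.arr_snd_injective
    rw [arr_Fmor, hid]
    rfl
  · apply Mor.arr_snd_injective
    rw [Mor.arr_add, arr_Fmor, arr_Fmor, arr_Fmor, mul_mul_mul_comm, arr_mul_arr,
      mul_assoc, ← mul_assoc (arr (P.id y)), hid, one_mul]
  · apply Mor.arr_snd_injective
    have hinv : arr (P.id (neg (P.tensor y y'))) =
        arr (P.id (neg y)) * arr (P.id (neg y')) := by
      refine left_inv_eq_right_inv (a := arr (P.id (P.tensor y y'))) ?_ ?_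
      · rw [mul_comm, hid]
      · rw [arr_id_tensor, mul_mul_mul_comm, hid, hid, mul_one]
    rw [Mor.arr_add, arr_Fmor, arr_Fmor, arr_Fmor, arr_tHom, hinv, mul_mul_mul_comm]
  · have h' : arr f * arr (P.id (neg y)) = arr g * arr (P.id (neg y)) := by
      rw [← arr_Fmor neg hneg, ← arr_Fmor neg hneg, h]
    apply arr_injective
    have := congrArg (· * arr (P.id y)) h'
    simpa only [mul_assoc, mul_comm (arr (P.id (neg y))), hid, mul_one] using this
  · subst hb
    refine ⟨cast (congrArg (P.Hom _) (P.unit_left y)) (P.tHom b.2 (P.id y)), ?_⟩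
    apply Mor.arr_snd_injective
    rw [arr_Fmor, arr_cast (P.unit_left y), arr_tHom, mul_assoc, hid, mul_one]
end

section
/- Let d : B → D and d' : B' → D' be abelian crossed modules. The assignment (f₁, f₀) ↦ F, with F(x) = f₀(x) on objects and F(b : x → y) = f₁(b) on morphisms, is a bijection from the set of homomorphisms of abelian crossed modules (d : B → D) → (d' : B' → D') onto the set of strict regular symmetric monoidal functors P_{B→D} → P_{B'→D'}, i.e. those regular symmetric monoidal functors (F, F̃) with F̃_{x,y} = id for all objects x, y. -/
section

variable {B D B' D' : Type*} [AddCommGroup B] [AddCommGroup D]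
  [AddCommGroup B'] [AddCommGroup D']

/-- A regular symmetric monoidal functor `(F, F̃) : P_{B→D} → P_{B'→D'}` between the
strict Picard categories associated to abelian crossed modules.  A morphism `x → y`
of `P_{B→D}` is an element `b : B` with `x = d b + y`; composition is addition, the
tensor product is addition, and all constraints are identities. -/
structure RegSymMonFun (d : B →+ D) (d' : B' →+ D') where
  /-- the object map -/
  F₀ : D → D'
  /-- the morphism map -/
  Fm : ∀ (x y : D) (b : B), x = d b + y → B'
  /-- the monoidal structure isomorphisms `F̃_{x,y}` -/
  Ft : D → D → B'
  /-- `F` sends morphisms `x → y` to morphisms `F₀ x → F₀ y` -/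
  mor : ∀ (x y : D) (b : B) (h : x = d b + y), F₀ x = d' (Fm x y b h) + F₀ y
  /-- `F` preserves identities -/
  map_id : ∀ (x : D) (h : x = d 0 + x), Fm x x 0 h = 0
  /-- `F` preserves composition -/
  map_comp : ∀ (x y z : D) (b c : B) (h1 : x = d b + y) (h2 : y = d c + z)
      (h : x = d (b + c) + z), Fm x z (b + c) h = Fm x y b h1 + Fm y z c h2
  /-- `F̃_{x,y}` is a morphism `F₀ x + F₀ y → F₀ (x + y)` -/
  Ft_mor : ∀ x y : D, F₀ x + F₀ y = d' (Ft x y) + F₀ (x + y)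
  /-- `F̃` is natural -/
  Ft_nat : ∀ (x x' y y' : D) (b c : B) (h1 : x = d b + x') (h2 : y = d c + y')
      (h : x + y = d (b + c) + (x' + y')),
      Fm x x' b h1 + Fm y y' c h2 + Ft x' y' = Ft x y + Fm (x + y) (x' + y') (b + c) h
  /-- compatibility with the identity associativity constraints -/
  Ft_assoc : ∀ x y z : D, Ft x y + Ft (x + y) z = Ft y z + Ft x (y + z)
  /-- compatibility with the identity unit constraints -/
  Ft_unit_right : ∀ x : D, Ft x 0 = 0
  Ft_unit_left : ∀ y : D, Ft 0 y = 0
  /-- compatibility with the identity symmetry constraints -/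
  Ft_symm : ∀ x y : D, Ft x y = Ft y x
  /-- `F` is regular -/
  regular : ∀ x y : D, F₀ (x + y) = F₀ x + F₀ y

namespace RegSymMonFun

variable {d : B →+ D} {d' : B' →+ D'}

theorem ext_of_eq {G H : RegSymMonFun d d'} (h₀ : G.F₀ = H.F₀)
    (hm : ∀ x y b h, G.Fm x y b h = H.Fm x y b h) (ht : ∀ x y, G.Ft x y = H.Ft x y) :
    G = H := by
  have hm' : G.Fm = H.Fm := by
    funext x y b h
    exact hm x y b h
  have ht' : G.Ft = H.Ft := by
    funext x y
    exact ht x y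
  cases G
  cases H
  subst h₀ hm' ht'
  rfl

theorem Fm_congr (G : RegSymMonFun d d') {x x' y y' : D} {b b' : B} (hx : x = x')
    (hy : y = y') (hb : b = b') (h : x = d b + y) (h' : x' = d b' + y') :
    G.Fm x y b h = G.Fm x' y' b' h' := by
  subst hx hy hb
  rfl

/-- The value of a functor on the morphism `b : d b → 0`. -/
def toZero (G : RegSymMonFun d d') (b : B) : B' :=
  G.Fm (d b) 0 b (add_zero _).symm

theorem Fm_eq_toZero (G : RegSymMonFun d d') (hG : ∀ x y, G.Ft x y = 0) (x y : D) (b : B)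
    (h : x = d b + y) : G.Fm x y b h = G.toZero b := by
  have key := G.Ft_nat (d b) 0 y y b 0 (add_zero _).symm (by simp) (by simp)
  rw [hG, hG, G.map_id, add_zero, add_zero, zero_add] at key
  exact (G.Fm_congr h (zero_add y).symm (add_zero b).symm _ _).trans key.symm

theorem toZero_add (G : RegSymMonFun d d') (hG : ∀ x y, G.Ft x y = 0) (b c : B) :
    G.toZero (b + c) = G.toZero b + G.toZero c := by
  have key := G.map_comp (d (b + c)) (d c) 0 b c (by simp) (add_zero _).symm (add_zero _).symm
  rwa [G.Fm_eq_toZero hG, G.Fm_eq_toZero hG, G.Fm_eq_toZero hG] at key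

/-- The strict functor induced by a homomorphism of abelian crossed modules. -/
def ofHom (f₁ : B →+ B') (f₀ : D →+ D') (hf : ∀ b, f₀ (d b) = d' (f₁ b)) :
    RegSymMonFun d d' where
  F₀ := f₀
  Fm _ _ b _ := f₁ b
  Ft _ _ := 0
  mor x y b h := by rw [h, map_add, hf]
  map_id _ _ := map_zero f₁
  map_comp _ _ _ b c _ _ _ := map_add f₁ b c
  Ft_mor x y := by simp
  Ft_nat _ _ _ _ b c _ _ _ := by simp
  Ft_assoc _ _ _ := rfl
  Ft_unit_right _ := rfl
  Ft_unit_left _ := rfl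
  Ft_symm _ _ := rfl
  regular := map_add f₀

theorem F₀_map_eq (G : RegSymMonFun d d') (b : B) : G.F₀ (d b) = d' (G.toZero b) := by
  have h0 : G.F₀ 0 = 0 := by simpa using G.regular 0 0
  have key := G.mor (d b) 0 b (add_zero _).symm
  rwa [h0, add_zero] at key

end RegSymMonFun

/-- **Statement 11.** The assignment `(f₁, f₀) ↦ F` (`F x = f₀ x` on objects,
`F (b : x → y) = f₁ b` on morphisms) is a bijection from the set of homomorphisms of
abelian crossed modules `(d : B → D) → (d' : B' → D')` onto the set of *strict*
regular symmetric monoidal functors `P_{B→D} → P_{B'→D'}`, i.e. those with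
`F̃_{x,y} = id` for all `x, y`. -/
theorem acmHom_equiv_strictRegSymMonFun (d : B →+ D) (d' : B' →+ D') :
    ∃ e : {p : (B →+ B') × (D →+ D') // ∀ b : B, p.2 (d b) = d' (p.1 b)} ≃
          {G : RegSymMonFun d d' // ∀ x y : D, G.Ft x y = 0},
      ∀ t,
        (e t : {G : RegSymMonFun d d' // ∀ x y : D, G.Ft x y = 0}).1.F₀ = t.1.2 ∧
        (∀ (x y : D) (b : B) (h : x = d b + y), (e t).1.Fm x y b h = t.1.1 b) := by
  refine ⟨{ toFun := fun t => ⟨RegSymMonFun.ofHom t.1.1 t.1.2 t.2, fun _ _ => rfl⟩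
            invFun := fun G =>
              ⟨(AddMonoidHom.mk' G.1.toZero (G.1.toZero_add G.2),
                AddMonoidHom.mk' G.1.F₀ G.1.regular), G.1.F₀_map_eq⟩
            left_inv := fun _ => rfl
            right_inv := fun G => Subtype.ext <| RegSymMonFun.ext_of_eq rfl
              (fun x y b h => (G.1.Fm_eq_toZero G.2 x y b h).symm)
              (fun x y => (G.2 x y).symm) },
    fun _ => ⟨rfl, fun _ _ _ _ => rfl⟩⟩

end
end

section
/- Let (ξ, η) ∈ Z³_s(M, N) and (ξ', η') ∈ Z³_s(M', N'), let S = (M, N, ξ, η) and S' = (M', N', ξ', η') be the associated Picard categories, and let φ : M → M' and f : N → N' be group homomorphisms. If there exists at least one symmetric monoidal functor S → S' of type (φ, f), then the set Hom^{Pic}_{(φ,f)}[S, S'] of homotopy classes (under symmetric monoidal natural equivalence) of symmetric monoidal functors S → S' of type (φ, f) is in bijection with H²_s(M, N'). -/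
section

variable {M N M' N' : Type*} [AddCommGroup M] [AddCommGroup N]
  [AddCommGroup M'] [AddCommGroup N']

/-- `(ξ, η)` is a symmetric 3-cocycle on `M` with values in `N`. -/
def IsSymm3Cocycle (ξ : M → M → M → N) (η : M → M → N) : Prop :=
  (∀ y z, ξ 0 y z = 0) ∧ (∀ x z, ξ x 0 z = 0) ∧ (∀ x y, ξ x y 0 = 0) ∧
  (∀ x y z t, ξ y z t - ξ (x + y) z t + ξ x (y + z) t - ξ x y (z + t) + ξ x y z = 0) ∧
  (∀ x y, η x y + η y x = 0) ∧
  (∀ x y z, ξ x y z - ξ y x z + ξ y z x + η x (y + z) - η x y - η x z = 0)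

/-- A symmetric monoidal functor `S = (M, N, ξ, η) → S' = (M', N', ξ', η')` of type
`(φ, f)`: it is given on objects by `φ`, on morphisms by `(a, x) ↦ (f a, φ x)`,
so the remaining data is `F̃ = (Ft x y, ...)` and `F_* = (Fs, 0)`, subject to the
coherence conditions of a symmetric monoidal functor (naturality of `F̃` holds
automatically since `f` is additive and `N'` is abelian). -/
structure TypedSMF (ξ : M → M → M → N) (η : M → M → N)
    (ξ' : M' → M' → M' → N') (η' : M' → M' → N')
    (φ : M →+ M') (f : N →+ N') where
  Ft : M → M → N'
  Fs : N'
  assoc : ∀ x y z : M,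
    Ft x y + Ft (x + y) z + f (ξ x y z)
      = ξ' (φ x) (φ y) (φ z) + Ft y z + Ft x (y + z)
  unit_right : ∀ x : M, Fs + Ft x 0 = 0
  unit_left : ∀ y : M, Fs + Ft 0 y = 0
  symm : ∀ x y : M, η' (φ x) (φ y) + Ft y x = Ft x y + f (η x y)

/-- Homotopy (symmetric monoidal natural equivalence) between two symmetric
monoidal functors of the same type `(φ, f)`: a family `θ x : φ x → φ x`
compatible with the monoidal structures and the unit morphisms. -/
def Homotopic {ξ : M → M → M → N} {η : M → M → N}
    {ξ' : M' → M' → M' → N'} {η' : M' → M' → N'} {φ : M →+ M'} {f : N →+ N'}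
    (G G' : TypedSMF ξ η ξ' η' φ f) : Prop :=
  ∃ θ : M → N',
    (∀ x y : M, G'.Ft x y + θ x + θ y = θ (x + y) + G.Ft x y) ∧
    G.Fs + θ 0 = G'.Fs

/-- The group `Z²ₛ(M, N')` of symmetric 2-cocycles. -/
def SymmZ2 (M N' : Type*) [AddCommGroup M] [AddCommGroup N'] : Type _ :=
  {c : M → M → N' // (∀ y, c 0 y = 0) ∧ (∀ x, c x 0 = 0) ∧
    (∀ x y z, c y z + c x (y + z) = c x y + c (x + y) z) ∧
    (∀ x y, c x y = c y x)}

/-- Two symmetric 2-cocycles differ by a symmetric 2-coboundary;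
`H²ₛ(M, N')` is the quotient of `Z²ₛ(M, N')` by this relation. -/
def Cohomologous (c c' : SymmZ2 M N') : Prop :=
  ∃ α : M → N', α 0 = 0 ∧ ∀ x y, c.1 x y = c'.1 x y + α x + α y - α (x + y)

namespace TypedSMF

variable {ξ : M → M → M → N} {η : M → M → N} {ξ' : M' → M' → M' → N'} {η' : M' → M' → N'}
  {φ : M →+ M'} {f : N →+ N'}

/-- The symmetric 2-cocycle measuring the difference of two functors of the same type,
normalized by the difference of their unit constraints. -/
def diffCocycle (G₀ G : TypedSMF ξ η ξ' η' φ f) : SymmZ2 M N' :=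
  ⟨fun x y => G.Ft x y - G₀.Ft x y + (G.Fs - G₀.Fs), by
    intro y
    have h₁ := G.unit_left y
    have h₂ := G₀.unit_left y
    grind, by
    intro x
    have h₁ := G.unit_right x
    have h₂ := G₀.unit_right x
    grind, by
    intro x y z
    have h₁ := G.assoc x y z
    have h₂ := G₀.assoc x y z
    grind, by
    intro x y
    have h₁ := G.symm x y
    have h₂ := G₀.symm x y
    grind⟩

/-- Twisting a functor by a symmetric 2-cocycle. -/
def twist (G₀ : TypedSMF ξ η ξ' η' φ f) (c : SymmZ2 M N') : TypedSMF ξ η ξ' η' φ f where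
  Ft x y := G₀.Ft x y + c.1 x y
  Fs := G₀.Fs
  assoc x y z := by
    have h₁ := c.2.2.2.1 x y z
    have h₂ := G₀.assoc x y z
    grind
  unit_right x := by rw [c.2.2.1, add_zero, G₀.unit_right]
  unit_left y := by rw [c.2.1, add_zero, G₀.unit_left]
  symm x y := by
    have h₁ := c.2.2.2.2 x y
    have h₂ := G₀.symm x y
    grind

theorem cohomologous_diffCocycle (G₀ : TypedSMF ξ η ξ' η' φ f)
    {G G' : TypedSMF ξ η ξ' η' φ f} (h : Homotopic G G') :
    Cohomologous (G₀.diffCocycle G) (G₀.diffCocycle G') := by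
  obtain ⟨θ, hθ, hu⟩ := h
  refine ⟨fun x => θ x - θ 0, sub_self _, fun x y => ?_⟩
  have h₁ := hθ x y
  simp only [diffCocycle]
  grind

theorem homotopic_twist (G₀ : TypedSMF ξ η ξ' η' φ f) {c c' : SymmZ2 M N'}
    (h : Cohomologous c c') : Homotopic (G₀.twist c) (G₀.twist c') := by
  obtain ⟨α, hα, hc⟩ := h
  refine ⟨α, fun x y => ?_, by simp [twist, hα]⟩
  have h₁ := hc x y
  simp only [twist]
  grind

theorem homotopic_twist_diffCocycle (G₀ G : TypedSMF ξ η ξ' η' φ f) :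
    Homotopic (G₀.twist (G₀.diffCocycle G)) G := by
  refine ⟨fun _ => G.Fs - G₀.Fs, fun x y => ?_, ?_⟩ <;> simp only [twist, diffCocycle] <;> abel

theorem diffCocycle_twist (G₀ : TypedSMF ξ η ξ' η' φ f) (c : SymmZ2 M N') :
    G₀.diffCocycle (G₀.twist c) = c := by
  apply Subtype.ext
  funext x y
  simp [twist, diffCocycle]

end TypedSMF

/-- **Statement 14.** Let `(ξ, η) ∈ Z³ₛ(M, N)`, `(ξ', η') ∈ Z³ₛ(M', N')`, and let
`φ : M → M'`, `f : N → N'` be group homomorphisms.  If there exists at least one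
symmetric monoidal functor `S → S'` of type `(φ, f)`, then the set
`Hom^{Pic}_{(φ,f)}[S, S']` of homotopy classes of symmetric monoidal functors of
type `(φ, f)` is in bijection with `H²ₛ(M, N')`. -/
theorem homotopy_classes_biject_with_H2
    (ξ : M → M → M → N) (η : M → M → N) (hξη : IsSymm3Cocycle ξ η)
    (ξ' : M' → M' → M' → N') (η' : M' → M' → N') (hξη' : IsSymm3Cocycle ξ' η')
    (φ : M →+ M') (f : N →+ N')
    (hne : Nonempty (TypedSMF ξ η ξ' η' φ f)) :
    Nonempty (Quot (@Homotopic M N M' N' _ _ _ _ ξ η ξ' η' φ f)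
      ≃ Quot (@Cohomologous M N' _ _)) := by
  obtain ⟨G₀⟩ := hne
  exact ⟨{
    toFun := Quot.map G₀.diffCocycle fun _ _ => G₀.cohomologous_diffCocycle
    invFun := Quot.map G₀.twist fun _ _ => G₀.homotopic_twist
    left_inv := by
      rintro ⟨G⟩
      exact Quot.sound (G₀.homotopic_twist_diffCocycle G)
    right_inv := by
      rintro ⟨c⟩
      exact congrArg (Quot.mk _) (G₀.diffCocycle_twist c) }⟩

end
end

section
/- Let d : B → D be an abelian crossed module, Q an abelian group, ψ : Q → Coker d a group homomorphism, and let (F, f) and (F', f') be factor pairs for (d, ψ) with associated extensions (E₀, j₀, p₀, ε) and (E₀', j₀', p₀', ε'). Then there exists a function α : Q → B with α(0) = 0, F(u) = d(α(u)) + F'(u) for all u, and f(u, v) + α(u + v) = α(u) + α(v) + f'(u, v) for all u, v, if and only if the two extensions are equivalent; moreover, in that case β(b, u) = (b + α(u), u) is such an equivalence. -/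
/-- A factor pair for `(d, ψ)`. -/
def IsFactorPair {B D Q : Type*} [AddCommGroup B] [AddCommGroup D] [AddCommGroup Q]
    (d : B →+ D) (ψ : Q →+ D ⧸ d.range) (F : Q → D) (f : Q → Q → B) : Prop :=
  F 0 = 0 ∧
  (∀ u, QuotientAddGroup.mk (F u) = ψ u) ∧
  (∀ u v, d (f u v) = F u + F v - F (u + v)) ∧
  (∀ v, f 0 v = 0) ∧ (∀ u, f u 0 = 0) ∧
  (∀ u v t, f v t + f u (v + t) = f u v + f (u + v) t) ∧
  (∀ u v, f u v = f v u)

/-- `β` is an equivalence between the extensions associated to the factor pairs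
`(F, f)` and `(F', f')`: a group isomorphism `B × Q → B × Q` (with respect to the
two semidirect-product operations) commuting with the structural maps `j₀`, `p₀`
and `ε`. -/
def IsExtensionEquiv {B D Q : Type*} [AddCommGroup B] [AddCommGroup D] [AddCommGroup Q]
    (d : B →+ D) (F : Q → D) (f : Q → Q → B) (F' : Q → D) (f' : Q → Q → B)
    (β : B × Q → B × Q) : Prop :=
  Function.Bijective β ∧
  (∀ p q : B × Q,
      β (p.1 + q.1 + f p.2 q.2, p.2 + q.2)
        = ((β p).1 + (β q).1 + f' (β p).2 (β q).2, (β p).2 + (β q).2)) ∧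
  (∀ b : B, β (b, 0) = (b, 0)) ∧
  (∀ p : B × Q, (β p).2 = p.2) ∧
  (∀ p : B × Q, d (β p).1 + F' (β p).2 = d p.1 + F p.2)

section

variable {B D Q : Type*} [AddCommGroup B] [AddCommGroup D] [AddCommGroup Q]
  {d : B →+ D} {F F' : Q → D} {f f' : Q → Q → B}

/-- A shear by `α` satisfying the coboundary relations is an equivalence of extensions. -/
theorem isExtensionEquiv_shear {α : Q → B} (h0 : α 0 = 0)
    (hF : ∀ u, F u = d (α u) + F' u)
    (hf : ∀ u v, f u v + α (u + v) = α u + α v + f' u v) :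
    IsExtensionEquiv d F f F' f' (fun p => (p.1 + α p.2, p.2)) := by
  refine ⟨⟨?_, ?_⟩, ?_, ?_, ?_, ?_⟩
  · rintro ⟨b, u⟩ ⟨c, v⟩ h
    obtain ⟨h1, rfl⟩ := Prod.mk.inj h
    exact Prod.ext (add_right_cancel h1) rfl
  · rintro ⟨b, u⟩
    exact ⟨(b - α u, u), by simp⟩
  · rintro ⟨b, u⟩ ⟨c, v⟩
    refine Prod.ext ?_ rfl
    change b + c + f u v + α (u + v) = b + α u + (c + α v) + f' u v
    rw [add_assoc, hf]
    abel
  · intro b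
    simp [h0]
  · intro p
    rfl
  · rintro ⟨b, u⟩
    simp [hF, add_assoc]

/-- An equivalence of extensions is determined by its values on `0 × Q`. -/
theorem IsExtensionEquiv.apply_eq_shear {β : B × Q → B × Q}
    (h : IsExtensionEquiv d F f F' f' β) (hf : ∀ v, f 0 v = 0) (hf' : ∀ v, f' 0 v = 0)
    (b : B) (u : Q) : β (b, u) = (b + (β (0, u)).1, u) := by
  obtain ⟨-, hadd, hj, hp, -⟩ := h
  simpa [hf, hf', hj, hp] using hadd (b, 0) (0, u)

end

/-- **Statement 16.** Let `(F, f)` and `(F', f')` be factor pairs for `(d, ψ)` with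
associated semidirect-product extensions.  There exists `α : Q → B` with `α 0 = 0`,
`F u = d (α u) + F' u` and `f u v + α (u + v) = α u + α v + f' u v` if and only if
the two extensions are equivalent; moreover, in that case
`β (b, u) = (b + α u, u)` is such an equivalence. -/
theorem extensions_equivalent_iff_factor_pairs_differ_by_alpha
    {B D Q : Type*} [AddCommGroup B] [AddCommGroup D] [AddCommGroup Q]
    (d : B →+ D) (ψ : Q →+ D ⧸ d.range)
    (F : Q → D) (f : Q → Q → B) (hFP : IsFactorPair d ψ F f)
    (F' : Q → D) (f' : Q → Q → B) (hFP' : IsFactorPair d ψ F' f') :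
    ((∃ α : Q → B, α 0 = 0 ∧ (∀ u, F u = d (α u) + F' u) ∧
        (∀ u v, f u v + α (u + v) = α u + α v + f' u v)) ↔
      (∃ β : B × Q → B × Q, IsExtensionEquiv d F f F' f' β)) ∧
    (∀ α : Q → B, α 0 = 0 → (∀ u, F u = d (α u) + F' u) →
      (∀ u v, f u v + α (u + v) = α u + α v + f' u v) →
      IsExtensionEquiv d F f F' f' (fun p => (p.1 + α p.2, p.2))) := by
  obtain ⟨-, -, -, hf, -⟩ := hFP
  obtain ⟨-, -, -, hf', -⟩ := hFP'
  refine ⟨⟨fun ⟨α, h0, hF, hα⟩ => ⟨_, isExtensionEquiv_shear h0 hF hα⟩, ?_⟩,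
    fun α h0 hF hα => isExtensionEquiv_shear h0 hF hα⟩
  rintro ⟨β, hβ⟩
  have shear := hβ.apply_eq_shear hf hf'
  obtain ⟨-, hadd, hj, hp, hε⟩ := hβ
  refine ⟨fun u => (β (0, u)).1, by simp [hj], fun u => ?_, fun u v => ?_⟩
  · simpa [hp] using (hε (0, u)).symm
  · have key := hadd (0, u) (0, v)
    simp only [zero_add, hp] at key
    rw [shear] at key
    exact congrArg Prod.fst key
end

section
/- Let d : B → D be an abelian crossed module, Q an abelian group and ψ : Q → Coker d a group homomorphism, and suppose there exists at least one extension of B by Q of type B → D inducing ψ. Then the set Ext^{ab}_{B→D}(Q, B, ψ) of equivalence classes of such extensions is in bijection with the symmetric cohomology group H²_s(Q, Ker d). -/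
universe u

section

variable {B D Q : Type u} [AddCommGroup B] [AddCommGroup D] [AddCommGroup Q]

/-- An extension of `B` by `Q` of type `B → D` inducing `ψ`: a short exact
sequence `0 → B → E → Q → 0` of abelian groups together with `ε : E → D` such that
`ε ∘ j = d` and `q ∘ ε = ψ ∘ p`. -/
structure ExtensionOfType (d : B →+ D) (ψ : Q →+ D ⧸ d.range) : Type (u + 1) where
  E : Type u
  [instE : AddCommGroup E]
  j : B →+ E
  p : E →+ Q
  ε : E →+ D
  inj : Function.Injective j
  surj : Function.Surjective p
  exact : ∀ x : E, p x = 0 ↔ x ∈ j.range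
  comm_j : ∀ b : B, ε (j b) = d b
  comm_p : ∀ x : E, QuotientAddGroup.mk (ε x) = ψ (p x)

/-- Equivalence of extensions; `Ext^{ab}_{B→D}(Q, B, ψ)` is the set of equivalence
classes. -/
def ExtRel (d : B →+ D) (ψ : Q →+ D ⧸ d.range) (X Y : ExtensionOfType d ψ) : Prop :=
  letI := X.instE; letI := Y.instE
  ∃ β : X.E → Y.E, Function.Bijective β ∧
    (∀ a b : X.E, β (a + b) = β a + β b) ∧
    (∀ b : B, β (X.j b) = Y.j b) ∧
    (∀ x : X.E, Y.p (β x) = X.p x) ∧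
    (∀ x : X.E, Y.ε (β x) = X.ε x)

/-- The group `Z²ₛ(Q, Ker d)` of symmetric 2-cocycles on `Q` with values in the
kernel of `d`. -/
def SymmZ2Ker (d : B →+ D) (Q : Type u) [AddCommGroup Q] : Type u :=
  {c : Q → Q → B //
    (∀ u v, c u v ∈ d.ker) ∧
    (∀ v, c 0 v = 0) ∧ (∀ u, c u 0 = 0) ∧
    (∀ u v t, c v t + c u (v + t) = c u v + c (u + v) t) ∧
    (∀ u v, c u v = c v u)}

/-- Two symmetric 2-cocycles differ by a symmetric 2-coboundary with values in
`Ker d`; `H²ₛ(Q, Ker d)` is the quotient of `Z²ₛ(Q, Ker d)` by this relation. -/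
def CobRel (d : B →+ D) {Q : Type u} [AddCommGroup Q]
    (c c' : SymmZ2Ker d Q) : Prop :=
  ∃ α : Q → B, (∀ u, α u ∈ d.ker) ∧ α 0 = 0 ∧
    ∀ u v, c.1 u v = c'.1 u v + α u + α v - α (u + v)

/-- A normalized symmetric 2-cocycle on `M` with values in `N`. -/
structure IsSymmetricCocycle {M N : Type*} [AddCommGroup M] [AddCommGroup N]
    (f : M → M → N) : Prop where
  zero_left : ∀ v, f 0 v = 0
  zero_right : ∀ u, f u 0 = 0
  cocycle : ∀ u v t, f v t + f u (v + t) = f u v + f (u + v) t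
  symm : ∀ u v, f u v = f v u

/-- The set `N × M`, to be equipped with the addition twisted by `f`. -/
@[ext]
structure TwistedSum {M N : Type*} (f : M → M → N) where
  fst : N
  snd : M

namespace TwistedSum

variable {M N : Type*} [AddCommGroup M] [AddCommGroup N]

/-- The abelian group structure on `N × M` determined by a symmetric 2-cocycle. -/
@[reducible]
def addCommGroup {f : M → M → N} (hf : IsSymmetricCocycle f) :
    AddCommGroup (TwistedSum f) :=
  letI : Add (TwistedSum f) := ⟨fun x y => ⟨x.fst + y.fst + f x.snd y.snd, x.snd + y.snd⟩⟩
  letI : Zero (TwistedSum f) := ⟨⟨0, 0⟩⟩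
  letI : Neg (TwistedSum f) := ⟨fun x => ⟨-x.fst - f (-x.snd) x.snd, -x.snd⟩⟩
  { AddGroup.ofLeftAxioms
      (fun x y z => by
        refine TwistedSum.ext ?_ (add_assoc x.snd y.snd z.snd)
        change x.fst + y.fst + f x.snd y.snd + z.fst + f (x.snd + y.snd) z.snd =
          x.fst + (y.fst + z.fst + f y.snd z.snd) + f x.snd (y.snd + z.snd)
        linear_combination (norm := abel) -hf.cocycle x.snd y.snd z.snd)
      (fun x => by
        refine TwistedSum.ext ?_ (zero_add x.snd)
        change 0 + x.fst + f 0 x.snd = x.fst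
        simp [hf.zero_left])
      (fun x => by
        refine TwistedSum.ext ?_ (neg_add_cancel x.snd)
        change -x.fst - f (-x.snd) x.snd + x.fst + f (-x.snd) x.snd = 0
        abel) with
    add_comm := fun x y => by
      refine TwistedSum.ext ?_ (add_comm x.snd y.snd)
      change x.fst + y.fst + f x.snd y.snd = y.fst + x.fst + f y.snd x.snd
      rw [hf.symm, add_comm x.fst] }

end TwistedSum

/-- A relation that is total on both sides and along which `r` and `r'` correspond
induces a bijection between the quotients. -/
theorem nonempty_quot_equiv_of_correspondence {α β : Type*} {r : α → α → Prop}
    {r' : β → β → Prop} (R : α → β → Prop) (left : ∀ a, ∃ b, R a b) (right : ∀ b, ∃ a, R a b)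
    (compat : ∀ a b a' b', R a b → R a' b' → (r a a' ↔ r' b b'))  (refl : ∀ a, r a a) :
    Nonempty (Quot r ≃ Quot r') := by
  choose F hF using left
  choose G hG using right
  exact ⟨{
    toFun := Quot.map F fun a a' h => (compat _ _ _ _ (hF a) (hF a')).1 h
    invFun := Quot.map G fun b b' h => (compat _ _ _ _ (hG b) (hG b')).2 h
    left_inv := by
      rintro ⟨a⟩
      exact Quot.sound ((compat _ _ _ _ (hG (F a)) (hF a)).2
        ((compat _ _ _ _ (hF a) (hF a)).1 (refl a)))
    right_inv := by
      rintro ⟨b⟩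
      exact Quot.sound ((compat _ _ _ _ (hF (G b)) (hG b)).1 (refl _)) }⟩

namespace ExtensionOfType

attribute [local instance] ExtensionOfType.instE

variable {d : B →+ D} {ψ : Q →+ D ⧸ d.range}

theorem p_j (X : ExtensionOfType d ψ) (b : B) : X.p (X.j b) = 0 :=
  (X.exact _).2 ⟨b, rfl⟩

theorem exists_j_eq_sub (X : ExtensionOfType d ψ) {x y : X.E} (h : X.p x = X.p y) :
    ∃ b, X.j b = x - y :=
  (X.exact _).1 (by rw [map_sub, h, sub_self])

/-- `s` is a normalized set-theoretic section lifting `η` whose factor set is `f`. -/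
structure IsSection (X : ExtensionOfType d ψ) (η : Q → D) (f : Q → Q → B)
    (s : Q → X.E) : Prop where
  apply_zero : s 0 = 0
  p_apply : ∀ u, X.p (s u) = u
  ε_apply : ∀ u, X.ε (s u) = η u
  add : ∀ u v, s u + s v = X.j (f u v) + s (u + v)

namespace IsSection

variable {X Y : ExtensionOfType d ψ} {η : Q → D} {f g : Q → Q → B} {s : Q → X.E} {t : Q → Y.E}

theorem isSymmetricCocycle (h : X.IsSection η f s) : IsSymmetricCocycle f where
  zero_left v := X.inj <| by simpa [h.apply_zero] using h.add 0 v
  zero_right u := X.inj <| by simpa [h.apply_zero] using h.add u 0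
  symm u v := X.inj <| by
    have := h.add u v
    rw [add_comm, h.add v u, add_comm v u] at this
    exact (add_right_cancel this).symm
  cocycle u v w := X.inj <| by
    have h₁ := h.add u (v + w)
    have h₂ := h.add (u + v) w
    rw [add_assoc] at h₂
    simp only [map_add]
    linear_combination (norm := abel) h.add u v - h.add v w - h₁ + h₂

theorem d_apply (h : X.IsSection η f s) (u v : Q) : d (f u v) = η u + η v - η (u + v) := by
  have := congrArg X.ε (h.add u v)
  simp only [map_add, h.ε_apply, X.comm_j] at this
  rw [this, add_sub_cancel_right]

theorem mk_apply (h : X.IsSection η f s) (u : Q) : (η u : D ⧸ d.range) = ψ u := by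
  rw [← h.ε_apply, X.comm_p, h.p_apply]

theorem zero_apply (h : X.IsSection η f s) : η 0 = 0 := by
  rw [← h.ε_apply, h.apply_zero, map_zero]

/-- Sections whose factor sets differ by a coboundary in `Ker d` give equivalent extensions. -/
theorem extRel (hs : X.IsSection η f s) (ht : Y.IsSection η g t) {α : Q → B}
    (hα : ∀ u, α u ∈ d.ker) (hα₀ : α 0 = 0)
    (h : ∀ u v, f u v = g u v + α u + α v - α (u + v)) : ExtRel d ψ X Y := by
  choose b hb using fun x : X.E => X.exists_j_eq_sub (hs.p_apply (X.p x)).symm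
  have hb_add (x y : X.E) : b (x + y) = b x + b y + f (X.p x) (X.p y) := X.inj <| by
    simp only [map_add, hb]
    linear_combination (norm := abel) hs.add (X.p x) (X.p y)
  have hb_section (c : B) (u : Q) : b (X.j c + s u) = c := X.inj <| by
    simp [hb, X.p_j, hs.p_apply]
  have hb_j (c : B) : b (X.j c) = c := by
    simpa [hs.apply_zero] using hb_section c 0
  let β : X.E →+ Y.E := AddMonoidHom.mk'
    (fun x => Y.j (b x + α (X.p x)) + t (X.p x)) fun x y => by
      have hfg := congrArg Y.j (h (X.p x) (X.p y))
      simp only [map_add, map_sub, hb_add] at hfg ⊢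
      linear_combination (norm := abel) hfg - ht.add (X.p x) (X.p y)
  have hβ (x : X.E) : β x = Y.j (b x + α (X.p x)) + t (X.p x) := rfl
  have hβp (x : X.E) : Y.p (β x) = X.p x := by simp [hβ, Y.p_j, ht.p_apply]
  refine ⟨β, ⟨(injective_iff_map_eq_zero β).2 fun x hx => ?_, fun y => ?_⟩, map_add β,
    fun c => ?_, hβp, fun x => ?_⟩
  · have hpx : X.p x = 0 := by rw [← hβp, hx, map_zero]
    have hbx := hb x
    rw [hβ, hpx, hα₀, ht.apply_zero, add_zero, add_zero] at hx
    rw [Y.inj (hx.trans (map_zero Y.j).symm), hpx, hs.apply_zero, map_zero, sub_zero] at hbx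
    exact hbx.symm
  · obtain ⟨c, hc⟩ := Y.exists_j_eq_sub (ht.p_apply (Y.p y)).symm
    refine ⟨X.j (c - α (Y.p y)) + s (Y.p y), ?_⟩
    rw [hβ, hb_section, map_add X.p, X.p_j, hs.p_apply, zero_add, sub_add_cancel, hc,
      sub_add_cancel]
  · simp [hβ, X.p_j, hb_j, hα₀, ht.apply_zero]
  · have hbx := congrArg X.ε (hb x)
    rw [X.comm_j, map_sub, hs.ε_apply] at hbx
    rw [hβ, map_add Y.ε, Y.comm_j, map_add d, hbx, ht.ε_apply, (hα _ : d _ = 0), add_zero,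
      sub_add_cancel]

/-- Factor sets of equivalent extensions differ by a coboundary in `Ker d`. -/
theorem exists_coboundary (hs : X.IsSection η f s) (ht : Y.IsSection η g t)
    (h : ExtRel d ψ X Y) :
    ∃ α : Q → B, (∀ u, α u ∈ d.ker) ∧ α 0 = 0 ∧
      ∀ u v, f u v = g u v + α u + α v - α (u + v) := by
  obtain ⟨β, -, hadd, hj, hp, hε⟩ := h
  have key (u : Q) : ∃ a, Y.j a = β (s u) - t u :=
    Y.exists_j_eq_sub (by rw [hp, hs.p_apply, ht.p_apply])
  choose α hα using key
  have hβ₀ : β 0 = 0 := by simpa using hj 0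
  refine ⟨α, fun u => ?_, Y.inj ?_, fun u v => Y.inj ?_⟩
  · rw [AddMonoidHom.mem_ker, ← Y.comm_j, hα, map_sub, hε, hs.ε_apply, ht.ε_apply, sub_self]
  · rw [hα, hs.apply_zero, hβ₀, ht.apply_zero, sub_zero, map_zero]
  · have hβ := congrArg β (hs.add u v)
    rw [hadd, hadd, hj] at hβ
    simp only [map_add, map_sub, hα]
    linear_combination (norm := abel) ht.add u v - hβ

end IsSection

/-- A section of the right projection has a factor set. -/
theorem exists_isSection_of_section (X : ExtensionOfType d ψ) {s : Q → X.E} (h₀ : s 0 = 0)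
    (hp : ∀ u, X.p (s u) = u) : ∃ f, X.IsSection (fun u => X.ε (s u)) f s := by
  choose f hf using fun u v => X.exists_j_eq_sub
    (show X.p (s u + s v) = X.p (s (u + v)) by simp only [map_add, hp])
  exact ⟨f, h₀, hp, fun _ => rfl, fun u v => by rw [hf, sub_add_cancel]⟩

/-- Any normalized lift of `ψ` to `D` lifts further to a section of `X`. -/
theorem exists_isSection (X : ExtensionOfType d ψ) {η : Q → D}
    (hη : ∀ u, (η u : D ⧸ d.range) = ψ u) (hη₀ : η 0 = 0) : ∃ f s, X.IsSection η f s := by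
  have key (u : Q) : ∃ x : X.E, X.p x = u ∧ X.ε x = η u ∧ (u = 0 → x = 0) := by
    by_cases hu : u = 0
    · exact ⟨0, by simp [hu], by simp [hu, hη₀], fun _ => rfl⟩
    obtain ⟨x, hx⟩ := X.surj u
    have hmk : (X.ε x : D ⧸ d.range) = η u := by rw [X.comm_p, hx, hη]
    obtain ⟨b, hb⟩ := QuotientAddGroup.eq.1 hmk
    refine ⟨x + X.j b, by rw [map_add, hx, X.p_j, add_zero], ?_, fun h => absurd h hu⟩
    rw [map_add, X.comm_j, hb, add_neg_cancel_left]
  choose s hp hε h₀ using key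
  obtain ⟨f, hf⟩ := X.exists_isSection_of_section (h₀ 0 rfl) hp
  rw [funext hε] at hf
  exact ⟨f, s, hf⟩

/-- Every symmetric cocycle with the correct image in `D` is the factor set of an extension. -/
theorem exists_of_isSymmetricCocycle {η : Q → D} {f : Q → Q → B}
    (hη : ∀ u, (η u : D ⧸ d.range) = ψ u) (hη₀ : η 0 = 0) (hf : IsSymmetricCocycle f)
    (hdf : ∀ u v, d (f u v) = η u + η v - η (u + v)) :
    ∃ (X : ExtensionOfType d ψ) (s : Q → X.E), X.IsSection η f s := by
  let := TwistedSum.addCommGroup hf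
  have add_def (x y : TwistedSum f) :
      x + y = ⟨x.fst + y.fst + f x.snd y.snd, x.snd + y.snd⟩ := rfl
  have zero_def : (0 : TwistedSum f) = ⟨0, 0⟩ := rfl
  refine ⟨{
    E := TwistedSum f
    j := AddMonoidHom.mk' (fun b => ⟨b, 0⟩) fun a b => by simp [add_def, hf.zero_left]
    p := AddMonoidHom.mk' TwistedSum.snd fun _ _ => rfl
    ε := AddMonoidHom.mk' (fun x => d x.fst + η x.snd) fun x y => by
      simp only [add_def, map_add, hdf]
      abel
    inj := fun a b h => congrArg TwistedSum.fst h
    surj := fun u => ⟨⟨0, u⟩, rfl⟩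
    exact := fun x => ⟨fun h => ⟨x.fst, TwistedSum.ext rfl h.symm⟩, by rintro ⟨b, rfl⟩; rfl⟩
    comm_j := fun b => by simp [hη₀]
    comm_p := fun x => ?_ }, fun u => ⟨0, u⟩, rfl, fun _ => rfl, fun u => ?_, fun u v => ?_⟩
  · change ((d x.fst + η x.snd : D) : D ⧸ d.range) = ψ x.snd
    rw [QuotientAddGroup.mk_add, (QuotientAddGroup.eq_zero_iff _).2 (d.mem_range.2 ⟨x.fst, rfl⟩),
      zero_add, hη]
  · simp
  · refine TwistedSum.ext ?_ (zero_add (u + v)).symm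
    change 0 + 0 + f u v = f u v + 0 + f 0 (u + v)
    simp [hf.zero_left]

end ExtensionOfType

theorem ExtRel.refl (d : B →+ D) (ψ : Q →+ D ⧸ d.range) (X : ExtensionOfType d ψ) :
    ExtRel d ψ X X :=
  ⟨id, Function.bijective_id, fun _ _ => rfl, fun _ => rfl, fun _ => rfl, fun _ => rfl⟩

/-- **Statement 19.** Let `d : B → D` be an abelian crossed module, `Q` an abelian
group and `ψ : Q → Coker d` a group homomorphism, and suppose that there exists at
least one extension of `B` by `Q` of type `B → D` inducing `ψ`.  Then the set
`Ext^{ab}_{B→D}(Q, B, ψ)` of equivalence classes of such extensions is in bijection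
with the symmetric cohomology group `H²ₛ(Q, Ker d)`. -/
theorem ext_classes_biject_with_H2 (d : B →+ D) (ψ : Q →+ D ⧸ d.range)
    (hne : Nonempty (ExtensionOfType d ψ)) :
    Nonempty (Quot (ExtRel d ψ) ≃ Quot (CobRel d (Q := Q))) := by
  obtain ⟨X₀⟩ := hne
  let := X₀.instE
  obtain ⟨η, f₀, s₀, h₀⟩ : ∃ η f s, X₀.IsSection η f s := by
    classical
    obtain ⟨s, hs⟩ := X₀.surj.hasRightInverse
    obtain ⟨f, hf⟩ := X₀.exists_isSection_of_section (s := Function.update s 0 0) (by simp)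
      fun u => by
        by_cases hu : u = 0
        · simp [hu]
        · rw [Function.update_of_ne hu, hs]
    exact ⟨_, f, _, hf⟩
  have hf₀ := h₀.isSymmetricCocycle
  refine nonempty_quot_equiv_of_correspondence
    (fun X c => ∃ s, X.IsSection η (fun u v => f₀ u v + c.1 u v) s) (fun X => ?_) (fun c => ?_) ?_
    (ExtRel.refl d ψ)
  · obtain ⟨f, s, hs⟩ := X.exists_isSection h₀.mk_apply h₀.zero_apply
    have hf := hs.isSymmetricCocycle
    refine ⟨⟨fun u v => f u v - f₀ u v, fun u v => ?_, fun v => ?_, fun u => ?_,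
      fun u v t => ?_, fun u v => ?_⟩, s, ?_⟩
    · rw [AddMonoidHom.mem_ker, map_sub, hs.d_apply, h₀.d_apply, sub_self]
    · simp only [hf.zero_left, hf₀.zero_left, sub_zero]
    · simp only [hf.zero_right, hf₀.zero_right, sub_zero]
    · dsimp only
      linear_combination (norm := abel) hf.cocycle u v t - hf₀.cocycle u v t
    · simp only [hf.symm u v, hf₀.symm u v]
    · simpa only [add_sub_cancel] using hs
  · obtain ⟨c, hker, hl, hr, hc, hsymm⟩ := c
    refine ExtensionOfType.exists_of_isSymmetricCocycle h₀.mk_apply h₀.zero_apply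
      ⟨fun v => ?_, fun u => ?_, fun u v t => ?_, fun u v => ?_⟩ fun u v => ?_
    · simp only [hl, hf₀.zero_left, add_zero]
    · simp only [hr, hf₀.zero_right, add_zero]
    · linear_combination (norm := abel) hf₀.cocycle u v t + hc u v t
    · simp only [hsymm u v, hf₀.symm u v]
    · rw [map_add, h₀.d_apply, (hker u v : d _ = 0), add_zero]
  · rintro X c Y c' ⟨s, hs⟩ ⟨t, ht⟩
    constructor
    · intro h
      obtain ⟨α, hα, hα₀, hcob⟩ := hs.exists_coboundary ht h
      exact ⟨α, hα, hα₀, fun u v => by linear_combination (norm := abel) hcob u v⟩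
    · rintro ⟨α, hα, hα₀, hcob⟩
      exact hs.extRel ht hα hα₀ fun u v => by linear_combination (norm := abel) hcob u v

end
end
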